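/- arXiv:2103.15275 — 8 statements merged into one kernel-verified Lean document; each statement's English description precedes it below -/
import Mathlib

section
/- The FIB operator F is a γ-contraction with respect to the sup norm: for all α, β : A → S → ℝ, ‖F α − F β‖_∞ ≤ γ · ‖α − β‖_∞. -/
open Finset Filter

/-- The fast informed bound (FIB) operator:
`(F α) a s = r s a + γ · Σ_o max_{a'} Σ_{s'} Ω s' a o · T s a s' · α a' s'`. -/
noncomputable def FIB {S A O : Type*} [Fintype S] [Fintype A] [Fintype O] [Nonempty A]
    (T : S → A → S → ℝ) (Ω : S → A → O → ℝ) (r : S → A → ℝ) (γ : ℝ)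
    (α : A → S → ℝ) : A → S → ℝ :=
  fun a s => r s a + γ * ∑ o : O,
    Finset.univ.sup' Finset.univ_nonempty
      (fun a' : A => ∑ s' : S, Ω s' a o * T s a s' * α a' s')

/-- The sup norm `‖α‖_∞ = max_{(a,s)} |α a s|` on `A → S → ℝ`. -/
noncomputable def supNorm {S A : Type*} [Fintype S] [Fintype A] [Nonempty S] [Nonempty A]
    (α : A → S → ℝ) : ℝ :=
  Finset.univ.sup' Finset.univ_nonempty (fun p : A × S => |α p.1 p.2|)

variable {S A O : Type*} [Fintype S] [Fintype A] [Fintype O]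
  [Nonempty S] [Nonempty A] [Nonempty O]

theorem fib_contraction
    (T : S → A → S → ℝ) (Ω : S → A → O → ℝ) (r : S → A → ℝ) (γ : ℝ)
    (hγ : 0 < γ) (hγ1 : γ < 1)
    (hT0 : ∀ s a s', 0 ≤ T s a s') (hT1 : ∀ s a, ∑ s' : S, T s a s' = 1)
    (hΩ0 : ∀ s' a o, 0 ≤ Ω s' a o) (hΩ1 : ∀ s' a, ∑ o : O, Ω s' a o = 1)
    :
    ∀ α β : A → S → ℝ,
      supNorm (FIB T Ω r γ α - FIB T Ω r γ β) ≤ γ * supNorm (α - β) := by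
  have key : ∀ (α β : A → S → ℝ) (a : A) (s : S),
      FIB T Ω r γ α a s - FIB T Ω r γ β a s ≤ γ * supNorm (α - β) := by
    intro α β a s
    have hM : ∀ a' s', α a' s' ≤ β a' s' + supNorm (α - β) := by
      intro a' s'
      have h : |(α - β) a' s'| ≤ supNorm (α - β) :=
        Finset.le_sup' (fun p : A × S => |(α - β) p.1 p.2|) (Finset.mem_univ (a', s'))
      have h2 := le_trans (le_abs_self _) h
      simp only [Pi.sub_apply] at h2
      linarith
    generalize supNorm (α - β) = M at hM ⊢
    have hsum : ∑ o : O, ∑ s' : S, Ω s' a o * T s a s' * M = M := by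
      rw [Finset.sum_comm]
      have : ∀ s' : S, ∑ o : O, Ω s' a o * T s a s' * M = T s a s' * M := by
        intro s'
        rw [← Finset.sum_mul, ← Finset.sum_mul, hΩ1, one_mul]
      simp only [this]
      rw [← Finset.sum_mul, hT1, one_mul]
    have hle : ∑ o : O, Finset.univ.sup' Finset.univ_nonempty
          (fun a' : A => ∑ s' : S, Ω s' a o * T s a s' * α a' s')
        ≤ ∑ o : O, Finset.univ.sup' Finset.univ_nonempty
          (fun a' : A => ∑ s' : S, Ω s' a o * T s a s' * β a' s') + M := by
      conv_rhs => rw [← hsum]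
      rw [← Finset.sum_add_distrib]
      refine Finset.sum_le_sum fun o _ => Finset.sup'_le _ _ fun a' _ => ?_
      have h1 := Finset.le_sup' (fun a' : A => ∑ s' : S, Ω s' a o * T s a s' * β a' s')
        (Finset.mem_univ a')
      refine le_trans ?_ (add_le_add_left h1 _)
      rw [← Finset.sum_add_distrib]
      refine Finset.sum_le_sum fun s' _ => ?_
      rw [← mul_add]
      exact mul_le_mul_of_nonneg_left (hM a' s') (mul_nonneg (hΩ0 _ _ _) (hT0 _ _ _))
    have := mul_le_mul_of_nonneg_left hle hγ.le
    simp only [FIB]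
    linarith
  intro α β
  have hsymm : supNorm (β - α) = supNorm (α - β) := by
    simp only [supNorm, Pi.sub_apply, abs_sub_comm]
  refine Finset.sup'_le _ _ fun p _ => ?_
  have h1 := key α β p.1 p.2
  have h2 := key β α p.1 p.2
  rw [hsymm] at h2
  simp only [Pi.sub_apply]
  exact abs_le.mpr ⟨by linarith, h1⟩
end

section
/- The FIB operator F has a unique fixed point: there exists a unique α⋆ : A → S → ℝ such that F α⋆ = α⋆ (the FIB solution). -/
open Finset Filter

variable {S A O : Type*} [Fintype S] [Fintype A] [Fintype O]
  [Nonempty S] [Nonempty A] [Nonempty O]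

theorem FIB_le_aux
    (T : S → A → S → ℝ) (Ω : S → A → O → ℝ) (r : S → A → ℝ) (γ : ℝ)
    (hγ : 0 < γ)
    (hT0 : ∀ s a s', 0 ≤ T s a s') (hT1 : ∀ s a, ∑ s' : S, T s a s' = 1)
    (hΩ0 : ∀ s' a o, 0 ≤ Ω s' a o) (hΩ1 : ∀ s' a, ∑ o : O, Ω s' a o = 1)
    (α β : A → S → ℝ) (a : A) (s : S) :
    FIB T Ω r γ α a s ≤ FIB T Ω r γ β a s + γ * dist α β := by
  have hd : ∀ a s, α a s ≤ β a s + dist α β := by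
    intro a s
    have h1 := (dist_le_pi_dist (α a) (β a) s).trans (dist_le_pi_dist α β a)
    rw [Real.dist_eq] at h1
    linarith [le_abs_self (α a s - β a s)]
  have hsum : ∑ o : O, ∑ s' : S, Ω s' a o * T s a s' * dist α β = dist α β := by
    rw [Finset.sum_comm]
    simp_rw [← Finset.sum_mul, hΩ1, one_mul, hT1, one_mul]
  have key : ∑ o : O, Finset.univ.sup' Finset.univ_nonempty
        (fun a' : A => ∑ s' : S, Ω s' a o * T s a s' * α a' s')
      ≤ ∑ o : O, Finset.univ.sup' Finset.univ_nonempty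
        (fun a' : A => ∑ s' : S, Ω s' a o * T s a s' * β a' s') + dist α β := by
    conv_rhs => rw [← hsum]
    rw [← Finset.sum_add_distrib]
    refine Finset.sum_le_sum fun o _ => Finset.sup'_le _ _ fun a' _ => ?_
    have h2 := Finset.le_sup' (fun a' : A => ∑ s' : S, Ω s' a o * T s a s' * β a' s')
      (Finset.mem_univ a')
    refine le_trans ?_ (add_le_add_left h2 _)
    rw [← Finset.sum_add_distrib]
    refine Finset.sum_le_sum fun s' _ => ?_
    rw [← mul_add]
    exact mul_le_mul_of_nonneg_left (hd a' s') (mul_nonneg (hΩ0 _ _ _) (hT0 _ _ _))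
  have := mul_le_mul_of_nonneg_left key hγ.le
  simp only [FIB]
  linarith

theorem fib_unique_fixed_point
    (T : S → A → S → ℝ) (Ω : S → A → O → ℝ) (r : S → A → ℝ) (γ : ℝ)
    (hγ : 0 < γ) (hγ1 : γ < 1)
    (hT0 : ∀ s a s', 0 ≤ T s a s') (hT1 : ∀ s a, ∑ s' : S, T s a s' = 1)
    (hΩ0 : ∀ s' a o, 0 ≤ Ω s' a o) (hΩ1 : ∀ s' a, ∑ o : O, Ω s' a o = 1)
    :
    ∃! αstar : A → S → ℝ, FIB T Ω r γ αstar = αstar := by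
  have hc : ContractingWith ⟨γ, hγ.le⟩ (FIB T Ω r γ) := by
    refine ⟨by exact_mod_cast hγ1, LipschitzWith.of_dist_le_mul fun α β => ?_⟩
    have h0 : 0 ≤ γ * dist α β := mul_nonneg hγ.le dist_nonneg
    refine (dist_pi_le_iff h0).2 fun a => (dist_pi_le_iff h0).2 fun s => ?_
    have h1 := FIB_le_aux T Ω r γ hγ hT0 hT1 hΩ0 hΩ1 α β a s
    have h2 := FIB_le_aux T Ω r γ hγ hT0 hT1 hΩ0 hΩ1 β α a s
    rw [dist_comm β α] at h2
    rw [Real.dist_eq, abs_le]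
    constructor <;> linarith
  exact ⟨ContractingWith.fixedPoint _ hc, hc.fixedPoint_isFixedPt,
    fun y hy => hc.fixedPoint_unique hy⟩
end

section
/- Theorem 1, case of finitely many accelerated steps: if ε ≥ 0, (e^k) satisfies ‖e^k‖_∞ ≤ ε for all k, and there exists K ∈ ℕ such that α^{k+1} = F α^k + e^k for all k ≥ K (i.e., the simulation-based AA-FIB algorithm eventually performs only fixed-point iteration steps), then liminf_{k→∞} ‖G(α^k)‖_∞ ≤ ((1 + γ)/(1 − γ)) · ε. -/
open Finset Filter

variable {S A O : Type*} [Fintype S] [Fintype A] [Fintype O]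
  [Nonempty S] [Nonempty A] [Nonempty O]

theorem fib_aux {S A O : Type*} [Fintype S] [Fintype A] [Fintype O] [Nonempty A]
    (T : S → A → S → ℝ) (Ω : S → A → O → ℝ) (r : S → A → ℝ) (γ : ℝ) (hγ : 0 < γ)
    (hT0 : ∀ s a s', 0 ≤ T s a s') (hT1 : ∀ s a, ∑ s' : S, T s a s' = 1)
    (hΩ0 : ∀ s' a o, 0 ≤ Ω s' a o) (hΩ1 : ∀ s' a, ∑ o : O, Ω s' a o = 1)
    (x y : A → S → ℝ) (d : ℝ) (h : ∀ a s, x a s ≤ y a s + d) (a : A) (s : S) :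
    FIB T Ω r γ x a s ≤ FIB T Ω r γ y a s + γ * d := by
  have hsum : ∑ o : O, ∑ s' : S, Ω s' a o * T s a s' * d = d := by
    rw [Finset.sum_comm]
    simp_rw [← Finset.sum_mul, hΩ1, one_mul, hT1, one_mul]
  have key : (∑ o : O, Finset.univ.sup' Finset.univ_nonempty
      (fun a' : A => ∑ s' : S, Ω s' a o * T s a s' * x a' s')) ≤
      (∑ o : O, Finset.univ.sup' Finset.univ_nonempty
      (fun a' : A => ∑ s' : S, Ω s' a o * T s a s' * y a' s')) + d := by
    conv_rhs => rw [← hsum]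
    rw [← Finset.sum_add_distrib]
    refine Finset.sum_le_sum fun o _ => Finset.sup'_le _ _ fun a' _ => ?_
    have h1 : ∑ s' : S, Ω s' a o * T s a s' * x a' s' ≤
        ∑ s' : S, Ω s' a o * T s a s' * y a' s' + ∑ s' : S, Ω s' a o * T s a s' * d := by
      rw [← Finset.sum_add_distrib]
      refine Finset.sum_le_sum fun s' _ => ?_
      rw [← mul_add]
      exact mul_le_mul_of_nonneg_left (h a' s') (mul_nonneg (hΩ0 _ _ _) (hT0 _ _ _))
    refine h1.trans (add_le_add_left ?_ _)
    exact Finset.le_sup' (fun a' : A => ∑ s' : S, Ω s' a o * T s a s' * y a' s')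
      (Finset.mem_univ a')
  have := mul_le_mul_of_nonneg_left key hγ.le
  unfold FIB
  linarith

theorem le_supNorm {S A : Type*} [Fintype S] [Fintype A] [Nonempty S] [Nonempty A]
    (x : A → S → ℝ) (a : A) (s : S) : |x a s| ≤ supNorm x :=
  Finset.le_sup' (fun p : A × S => |x p.1 p.2|) (Finset.mem_univ (a, s))

theorem supNorm_le {S A : Type*} [Fintype S] [Fintype A] [Nonempty S] [Nonempty A]
    (x : A → S → ℝ) (d : ℝ) (h : ∀ a s, |x a s| ≤ d) : supNorm x ≤ d :=
  Finset.sup'_le _ _ fun p _ => h p.1 p.2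

theorem supNorm_nonneg {S A : Type*} [Fintype S] [Fintype A] [Nonempty S] [Nonempty A]
    (x : A → S → ℝ) : 0 ≤ supNorm x :=
  (abs_nonneg _).trans (le_supNorm x (Classical.arbitrary A) (Classical.arbitrary S))

theorem aafib_residual_bound_finite_acceleration
    (T : S → A → S → ℝ) (Ω : S → A → O → ℝ) (r : S → A → ℝ) (γ : ℝ)
    (hγ : 0 < γ) (hγ1 : γ < 1)
    (hT0 : ∀ s a s', 0 ≤ T s a s') (hT1 : ∀ s a, ∑ s' : S, T s a s' = 1)
    (hΩ0 : ∀ s' a o, 0 ≤ Ω s' a o) (hΩ1 : ∀ s' a, ∑ o : O, Ω s' a o = 1)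
    (αstar : A → S → ℝ) (hstar : FIB T Ω r γ αstar = αstar)
    (ε : ℝ) (hε : 0 ≤ ε) (α : ℕ → A → S → ℝ) (e : ℕ → A → S → ℝ)
    (he : ∀ k, supNorm (e k) ≤ ε) (K : ℕ)
    (hrec : ∀ k, K ≤ k → α (k + 1) = FIB T Ω r γ (α k) + e k) :
    liminf (fun k => supNorm (α k - FIB T Ω r γ (α k))) atTop ≤
      (1 + γ) / (1 - γ) * ε := by
  have hc : ∀ k a s, |FIB T Ω r γ (α k) a s - αstar a s| ≤ γ * supNorm (α k - αstar) := by
    intro k a s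
    have hd : ∀ a s, |α k a s - αstar a s| ≤ supNorm (α k - αstar) :=
      fun a s => le_supNorm (α k - αstar) a s
    have h1 := fib_aux T Ω r γ hγ hT0 hT1 hΩ0 hΩ1 (α k) αstar (supNorm (α k - αstar))
      (fun a s => by have := abs_le.1 (hd a s); linarith [this.2]) a s
    have h2 := fib_aux T Ω r γ hγ hT0 hT1 hΩ0 hΩ1 αstar (α k) (supNorm (α k - αstar))
      (fun a s => by have := abs_le.1 (hd a s); linarith [this.1]) a s
    rw [hstar] at h1 h2
    rw [abs_le]
    constructor <;> linarith
  have hres : ∀ k, supNorm (α k - FIB T Ω r γ (α k)) ≤ (1 + γ) * supNorm (α k - αstar) := by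
    intro k
    refine supNorm_le _ _ fun a s => ?_
    have h1 := abs_le.1 (hc k a s)
    have h2 : |α k a s - αstar a s| ≤ _ := le_supNorm (α k - αstar) a s
    have h2 := abs_le.1 h2
    change |α k a s - FIB T Ω r γ (α k) a s| ≤ _
    rw [abs_le]
    constructor <;> linarith [h1.1, h1.2, h2.1, h2.2]
  have hstep : ∀ k, K ≤ k → supNorm (α (k + 1) - αstar) ≤ γ * supNorm (α k - αstar) + ε := by
    intro k hk
    refine supNorm_le _ _ fun a s => ?_
    have h1 := abs_le.1 (hc k a s)
    have h2 := abs_le.1 ((le_supNorm (e k) a s).trans (he k))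
    rw [hrec k hk]
    change |FIB T Ω r γ (α k) a s + e k a s - αstar a s| ≤ _
    rw [abs_le]
    constructor <;> linarith [h1.1, h1.2, h2.1, h2.2]
  have h1γ : 0 < 1 - γ := by linarith
  have hgeo : ∀ n, supNorm (α (K + n) - αstar) ≤
      γ ^ n * supNorm (α K - αstar) + ε / (1 - γ) := by
    intro n
    induction n with
    | zero =>
      have : 0 ≤ ε / (1 - γ) := by positivity
      simpa using this
    | succ n ih =>
      have h1 := hstep (K + n) (Nat.le_add_right _ _)
      have h2 := mul_le_mul_of_nonneg_left ih hγ.le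
      have h3 : γ * (ε / (1 - γ)) + ε = ε / (1 - γ) := by field_simp; ring
      rw [← add_assoc, pow_succ]
      linarith
  have hlim : Tendsto (fun n : ℕ => (1 + γ) * (γ ^ (n - K) * supNorm (α K - αstar) + ε / (1 - γ)))
      atTop (nhds ((1 + γ) / (1 - γ) * ε)) := by
    have h1 := (tendsto_pow_atTop_nhds_zero_of_lt_one hγ.le hγ1).comp (tendsto_sub_atTop_nat K)
    have h2 := ((h1.mul_const (supNorm (α K - αstar))).add_const (ε / (1 - γ))).const_mul (1 + γ)
    have h3 : (1 + γ) * (0 * supNorm (α K - αstar) + ε / (1 - γ)) = (1 + γ) / (1 - γ) * ε := by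
      ring
    rw [h3] at h2
    exact h2
  rw [← hlim.liminf_eq]
  refine liminf_le_liminf ?_ ?_ ?_
  · filter_upwards [eventually_ge_atTop K] with k hk
    refine (hres k).trans ?_
    have := hgeo (k - K)
    rw [Nat.add_sub_cancel' hk] at this
    exact mul_le_mul_of_nonneg_left this (by linarith)
  · exact isBoundedUnder_of ⟨0, fun k => supNorm_nonneg _⟩
  · exact hlim.isBoundedUnder_le.isCoboundedUnder_ge
end

section
/- Theorem 1, case of infinitely many accelerated steps: let ε ≥ 0, let (α^k) be any sequence in A → S → ℝ, let (e^k) satisfy ‖e^k‖_∞ ≤ ε for all k, and define the noisy residual g^k := α^k − F α^k − e^k. If there exist D > 0, φ > 0 and a strictly increasing sequence (k_i)_{i∈ℕ} of natural numbers such that ‖g^{k_i}‖_∞ ≤ D · ‖g^0‖_∞ · (i + 1)^{−(1+φ)} for all i (the safeguard condition of AA-FIB), then liminf_{k→∞} ‖G(α^k)‖_∞ ≤ ε, and in particular liminf_{k→∞} ‖G(α^k)‖_∞ ≤ ((1 + γ)/(1 − γ)) · ε. -/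
open Finset Filter

variable {S A O : Type*} [Fintype S] [Fintype A] [Fintype O]
  [Nonempty S] [Nonempty A] [Nonempty O]

theorem aafib_residual_bound_infinite_acceleration
    (T : S → A → S → ℝ) (Ω : S → A → O → ℝ) (r : S → A → ℝ) (γ : ℝ)
    (hγ : 0 < γ) (hγ1 : γ < 1)
    (hT0 : ∀ s a s', 0 ≤ T s a s') (hT1 : ∀ s a, ∑ s' : S, T s a s' = 1)
    (hΩ0 : ∀ s' a o, 0 ≤ Ω s' a o) (hΩ1 : ∀ s' a, ∑ o : O, Ω s' a o = 1)
    (ε : ℝ) (hε : 0 ≤ ε) (α : ℕ → A → S → ℝ) (e : ℕ → A → S → ℝ)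
    (he : ∀ k, supNorm (e k) ≤ ε)
    (g : ℕ → A → S → ℝ)
    (hg : ∀ k, g k = α k - FIB T Ω r γ (α k) - e k)
    (D φ : ℝ) (hD : 0 < D) (hφ : 0 < φ)
    (kseq : ℕ → ℕ) (hmono : StrictMono kseq)
    (hsafe : ∀ i : ℕ,
      supNorm (g (kseq i)) ≤ D * supNorm (g 0) * ((i : ℝ) + 1) ^ (-(1 + φ))) :
    liminf (fun k => supNorm (α k - FIB T Ω r γ (α k))) atTop ≤ ε ∧
    liminf (fun k => supNorm (α k - FIB T Ω r γ (α k))) atTop ≤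
      (1 + γ) / (1 - γ) * ε := by
  have key : liminf (fun k => supNorm (α k - FIB T Ω r γ (α k))) atTop ≤ ε := by
    have hnn : ∀ x : A → S → ℝ, 0 ≤ supNorm x := by
      intro x
      obtain ⟨p⟩ : Nonempty (A × S) := inferInstance
      exact (abs_nonneg _).trans
        (Finset.le_sup' (fun p : A × S => |x p.1 p.2|) (Finset.mem_univ p))
    have hadd : ∀ x y : A → S → ℝ, supNorm (x + y) ≤ supNorm x + supNorm y := by
      intro x y
      refine Finset.sup'_le _ _ fun p _ => ?_
      exact (abs_add_le _ _).trans (add_le_add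
        (Finset.le_sup' (fun p : A × S => |x p.1 p.2|) (Finset.mem_univ p))
        (Finset.le_sup' (fun p : A × S => |y p.1 p.2|) (Finset.mem_univ p)))
    have hlim : Tendsto (fun i : ℕ => D * supNorm (g 0) * ((i : ℝ) + 1) ^ (-(1 + φ)))
        atTop (nhds 0) := by
      have h1 := (tendsto_rpow_neg_atTop (y := 1 + φ) (by linarith)).comp
        (tendsto_atTop_add_const_right atTop (1 : ℝ) tendsto_natCast_atTop_atTop)
      simpa using h1.const_mul (D * supNorm (g 0))
    refine le_of_forall_pos_le_add fun δ hδ => ?_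
    refine liminf_le_of_frequently_le ?_
      (isBoundedUnder_of ⟨0, fun k => hnn _⟩)
    refine hmono.tendsto_atTop.frequently (Eventually.frequently ?_)
    filter_upwards [hlim.eventually (gt_mem_nhds hδ)] with i hi
    have h2 : α (kseq i) - FIB T Ω r γ (α (kseq i)) = e (kseq i) + g (kseq i) := by
      rw [hg]; abel
    rw [h2]
    have := hadd (e (kseq i)) (g (kseq i))
    have := he (kseq i)
    have := hsafe i
    linarith
  refine ⟨key, key.trans ?_⟩
  have h1 : 1 ≤ (1 + γ) / (1 - γ) := by
    rw [le_div_iff₀ (by linarith)]; linarith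
  nlinarith
end

section
/- Theorem 1 (combined): let ε ≥ 0, let (α^k) be a sequence in A → S → ℝ, let (e^k) satisfy ‖e^k‖_∞ ≤ ε for all k, and define g^k := α^k − F α^k − e^k. Assume that either (i) there exists K ∈ ℕ such that α^{k+1} = F α^k + e^k for all k ≥ K, or (ii) there exist D > 0, φ > 0 and a strictly increasing sequence (k_i)_{i∈ℕ} of natural numbers with ‖g^{k_i}‖_∞ ≤ D · ‖g^0‖_∞ · (i + 1)^{−(1+φ)} for all i. Then liminf_{k→∞} ‖G(α^k)‖_∞ ≤ ((1 + γ)/(1 − γ)) · ε. -/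
open Finset Filter

variable {S A O : Type*} [Fintype S] [Fintype A] [Fintype O]
  [Nonempty S] [Nonempty A] [Nonempty O]

theorem supNorm_eq_norm (α : A → S → ℝ) : supNorm α = ‖α‖ := by
  unfold supNorm
  apply le_antisymm
  · refine Finset.sup'_le _ _ fun p _ => ?_
    exact (norm_le_pi_norm (α p.1) p.2).trans (norm_le_pi_norm α p.1)
  · have key : ∀ a s, ‖α a s‖ ≤ Finset.univ.sup' Finset.univ_nonempty
        (fun p : A × S => |α p.1 p.2|) := fun a s =>
      Finset.le_sup' (fun p : A × S => |α p.1 p.2|) (Finset.mem_univ (a, s))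
    obtain ⟨a⟩ := ‹Nonempty A›
    obtain ⟨s⟩ := ‹Nonempty S›
    have h0 := (norm_nonneg _).trans (key a s)
    exact (pi_norm_le_iff_of_nonneg h0).2 fun a =>
      (pi_norm_le_iff_of_nonneg h0).2 fun s => key a s

theorem FIB_sub_le (T : S → A → S → ℝ) (Ω : S → A → O → ℝ) (r : S → A → ℝ) (γ : ℝ)
    (hγ : 0 < γ)
    (hT0 : ∀ s a s', 0 ≤ T s a s') (hT1 : ∀ s a, ∑ s' : S, T s a s' = 1)
    (hΩ0 : ∀ s' a o, 0 ≤ Ω s' a o) (hΩ1 : ∀ s' a, ∑ o : O, Ω s' a o = 1)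
    (α β : A → S → ℝ) (a : A) (s : S) :
    FIB T Ω r γ α a s ≤ FIB T Ω r γ β a s + γ * ‖α - β‖ := by
  have hsum : ∑ o : O, ∑ s' : S, Ω s' a o * T s a s' * ‖α - β‖ = ‖α - β‖ := by
    rw [Finset.sum_comm]
    simp_rw [← Finset.sum_mul, hΩ1, one_mul, hT1]
    rw [one_mul]
  have hle : ∑ o : O, Finset.univ.sup' Finset.univ_nonempty
      (fun a' : A => ∑ s' : S, Ω s' a o * T s a s' * α a' s') ≤
      ∑ o : O, Finset.univ.sup' Finset.univ_nonempty
      (fun a' : A => ∑ s' : S, Ω s' a o * T s a s' * β a' s') + ‖α - β‖ := by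
    rw [← hsum, ← Finset.sum_add_distrib]
    refine Finset.sum_le_sum fun o _ => Finset.sup'_le _ _ fun a' _ => ?_
    refine le_trans ?_ (add_le_add_left (Finset.le_sup'
      (fun a' : A => ∑ s' : S, Ω s' a o * T s a s' * β a' s') (Finset.mem_univ a')) _)
    rw [← Finset.sum_add_distrib]
    refine Finset.sum_le_sum fun s' _ => ?_
    rw [← mul_add]
    refine mul_le_mul_of_nonneg_left ?_ (mul_nonneg (hΩ0 _ _ _) (hT0 _ _ _))
    have h1 := (norm_le_pi_norm ((α - β) a') s').trans (norm_le_pi_norm (α - β) a')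
    have h2 := (le_abs_self _).trans h1
    simp only [Pi.sub_apply] at h2
    linarith
  have := mul_le_mul_of_nonneg_left hle hγ.le
  unfold FIB
  linarith

theorem FIB_contract (T : S → A → S → ℝ) (Ω : S → A → O → ℝ) (r : S → A → ℝ) (γ : ℝ)
    (hγ : 0 < γ)
    (hT0 : ∀ s a s', 0 ≤ T s a s') (hT1 : ∀ s a, ∑ s' : S, T s a s' = 1)
    (hΩ0 : ∀ s' a o, 0 ≤ Ω s' a o) (hΩ1 : ∀ s' a, ∑ o : O, Ω s' a o = 1)
    (α β : A → S → ℝ) :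
    ‖FIB T Ω r γ α - FIB T Ω r γ β‖ ≤ γ * ‖α - β‖ := by
  have h0 : 0 ≤ γ * ‖α - β‖ := mul_nonneg hγ.le (norm_nonneg _)
  refine (pi_norm_le_iff_of_nonneg h0).2 fun a => (pi_norm_le_iff_of_nonneg h0).2 fun s => ?_
  have h1 := FIB_sub_le T Ω r γ hγ hT0 hT1 hΩ0 hΩ1 α β a s
  have h2 := FIB_sub_le T Ω r γ hγ hT0 hT1 hΩ0 hΩ1 β α a s
  rw [norm_sub_rev β α] at h2
  rw [Real.norm_eq_abs, abs_le]
  simp only [Pi.sub_apply]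
  constructor <;> linarith

theorem liminf_le_of_subseq (u v : ℕ → ℝ) (c : ℝ) (k : ℕ → ℕ) (hu : ∀ n, 0 ≤ u n)
    (hk : StrictMono k) (hv : Tendsto v atTop (nhds 0)) (h : ∀ i, u (k i) ≤ v i + c) :
    liminf u atTop ≤ c := by
  refine le_of_forall_pos_le_add fun δ hδ => ?_
  refine liminf_le_of_frequently_le ?_ ?_
  · have : ∀ᶠ i in atTop, u (k i) ≤ c + δ := by
      filter_upwards [hv.eventually (gt_mem_nhds hδ)] with i hi
      linarith [h i]
    exact hk.tendsto_atTop.frequently this.frequently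
  · exact isBoundedUnder_of ⟨0, hu⟩

theorem aafib_residual_bound
    (T : S → A → S → ℝ) (Ω : S → A → O → ℝ) (r : S → A → ℝ) (γ : ℝ)
    (hγ : 0 < γ) (hγ1 : γ < 1)
    (hT0 : ∀ s a s', 0 ≤ T s a s') (hT1 : ∀ s a, ∑ s' : S, T s a s' = 1)
    (hΩ0 : ∀ s' a o, 0 ≤ Ω s' a o) (hΩ1 : ∀ s' a, ∑ o : O, Ω s' a o = 1)
    (αstar : A → S → ℝ) (hstar : FIB T Ω r γ αstar = αstar)
    (ε : ℝ) (hε : 0 ≤ ε) (α : ℕ → A → S → ℝ) (e : ℕ → A → S → ℝ)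
    (he : ∀ k, supNorm (e k) ≤ ε)
    (g : ℕ → A → S → ℝ)
    (hg : ∀ k, g k = α k - FIB T Ω r γ (α k) - e k)
    (hcases :
      (∃ K : ℕ, ∀ k, K ≤ k → α (k + 1) = FIB T Ω r γ (α k) + e k) ∨
      (∃ D φ : ℝ, ∃ kseq : ℕ → ℕ, 0 < D ∧ 0 < φ ∧ StrictMono kseq ∧
        ∀ i : ℕ,
          supNorm (g (kseq i)) ≤ D * supNorm (g 0) * ((i : ℝ) + 1) ^ (-(1 + φ)))) :
    liminf (fun k => supNorm (α k - FIB T Ω r γ (α k))) atTop ≤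
      (1 + γ) / (1 - γ) * ε := by
  simp only [supNorm_eq_norm] at *
  have hc := FIB_contract T Ω r γ hγ hT0 hT1 hΩ0 hΩ1
  have h1γ : 0 < 1 - γ := by linarith
  rcases hcases with ⟨K, hK⟩ | ⟨D, φ, k, hD, hφ, hk, hb⟩
  · have hd : ∀ n, ‖α (K + n) - αstar‖ ≤ γ ^ n * ‖α K - αstar‖ + ε / (1 - γ) := by
      intro n
      induction n with
      | zero =>
        have : 0 ≤ ε / (1 - γ) := div_nonneg hε h1γ.le
        simpa using this
      | succ n ih =>
        have e1 : α (K + (n + 1)) - αstar =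
            (FIB T Ω r γ (α (K + n)) - FIB T Ω r γ αstar) + e (K + n) := by
          rw [← add_assoc, hK (K + n) (by omega), hstar]
          abel
        rw [e1]
        have h1 := norm_add_le (FIB T Ω r γ (α (K + n)) - FIB T Ω r γ αstar) (e (K + n))
        have h2 := hc (α (K + n)) αstar
        have h3 := he (K + n)
        have h4 := mul_le_mul_of_nonneg_left ih hγ.le
        have h5 : γ * (γ ^ n * ‖α K - αstar‖ + ε / (1 - γ)) + ε =
            γ ^ (n + 1) * ‖α K - αstar‖ + ε / (1 - γ) := by
          field_simp
          ring
        linarith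
    refine liminf_le_of_subseq _ (fun n => γ ^ n * ((1 + γ) * ‖α K - αstar‖)) _ (fun n => K + n)
      (fun _ => norm_nonneg _) (fun a b hab => by simpa using hab) ?_ ?_
    · simpa using (tendsto_pow_atTop_nhds_zero_of_lt_one hγ.le hγ1).mul_const
        ((1 + γ) * ‖α K - αstar‖)
    · intro n
      have e1 : α (K + n) - FIB T Ω r γ (α (K + n)) =
          (α (K + n) - αstar) - (FIB T Ω r γ (α (K + n)) - FIB T Ω r γ αstar) := by
        rw [hstar]
        abel
      have h1 := norm_sub_le (α (K + n) - αstar) (FIB T Ω r γ (α (K + n)) - FIB T Ω r γ αstar)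
      rw [← e1] at h1
      have h2 := hc (α (K + n)) αstar
      have h3 := mul_le_mul_of_nonneg_left (hd n) (by linarith : 0 ≤ 1 + γ)
      have h4 : (1 + γ) * (γ ^ n * ‖α K - αstar‖ + ε / (1 - γ)) =
          γ ^ n * ((1 + γ) * ‖α K - αstar‖) + (1 + γ) / (1 - γ) * ε := by ring
      show ‖α (K + n) - FIB T Ω r γ (α (K + n))‖ ≤ _
      linarith
  · refine liminf_le_of_subseq _ (fun i : ℕ => D * ‖g 0‖ * ((i : ℝ) + 1) ^ (-(1 + φ))) _ k
      (fun _ => norm_nonneg _) hk ?_ ?_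
    · have h1 : Tendsto (fun i : ℕ => (i : ℝ) + 1) atTop atTop :=
        tendsto_atTop_add_const_right _ _ tendsto_natCast_atTop_atTop
      have h2 := (tendsto_rpow_neg_atTop (by linarith : 0 < 1 + φ)).comp h1
      simpa using h2.const_mul (D * ‖g 0‖)
    · intro i
      have e1 : α (k i) - FIB T Ω r γ (α (k i)) = g (k i) + e (k i) := by
        rw [hg]
        abel
      have h1 := norm_add_le (g (k i)) (e (k i))
      rw [← e1] at h1
      have h2 := he (k i)
      have h3 : ε ≤ (1 + γ) / (1 - γ) * ε := by
        refine le_mul_of_one_le_left hε ?_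
        rw [le_div_iff₀ h1γ]
        linarith
      have h4 := hb i
      linarith
end

section
/- Box invariance of the FIB operator: suppose r_min ≤ r s a ≤ r_max for all s ∈ S, a ∈ A. If α : A → S → ℝ satisfies r_min/(1−γ) ≤ α a s ≤ r_max/(1−γ) for all a, s, then F α also satisfies r_min/(1−γ) ≤ (F α) a s ≤ r_max/(1−γ) for all a, s. Consequently, the unique fixed point α⋆ of F satisfies r_min/(1−γ) ≤ α⋆ a s ≤ r_max/(1−γ) for all a, s. -/
open Finset Filter

variable {S A O : Type*} [Fintype S] [Fintype A] [Fintype O]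
  [Nonempty S] [Nonempty A] [Nonempty O]

theorem fib_lower_aux
    (T : S → A → S → ℝ) (Ω : S → A → O → ℝ) (r : S → A → ℝ) (γ : ℝ)
    (hγ : 0 < γ)
    (hT0 : ∀ s a s', 0 ≤ T s a s') (hT1 : ∀ s a, ∑ s' : S, T s a s' = 1)
    (hΩ0 : ∀ s' a o, 0 ≤ Ω s' a o) (hΩ1 : ∀ s' a, ∑ o : O, Ω s' a o = 1)
    (α : A → S → ℝ) (c : ℝ) (hc : ∀ a s, c ≤ α a s) (a : A) (s : S) :
    r s a + γ * c ≤ FIB T Ω r γ α a s := by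
  have key : ∑ o : O, ∑ s' : S, Ω s' a o * T s a s' * c = c := by
    rw [Finset.sum_comm]
    simp_rw [← Finset.sum_mul, hΩ1, one_mul, hT1]
    rw [one_mul]
  have h : c ≤ ∑ o : O, Finset.univ.sup' Finset.univ_nonempty
      (fun a' : A => ∑ s' : S, Ω s' a o * T s a s' * α a' s') := by
    refine le_trans key.ge (Finset.sum_le_sum fun o _ => ?_)
    refine le_trans ?_ (Finset.le_sup' (fun a' : A => ∑ s' : S, Ω s' a o * T s a s' * α a' s')
      (Finset.mem_univ a))
    exact Finset.sum_le_sum fun s' _ =>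
      mul_le_mul_of_nonneg_left (hc a s') (mul_nonneg (hΩ0 _ _ _) (hT0 _ _ _))
  unfold FIB
  have := mul_le_mul_of_nonneg_left h hγ.le
  linarith

theorem fib_upper_aux
    (T : S → A → S → ℝ) (Ω : S → A → O → ℝ) (r : S → A → ℝ) (γ : ℝ)
    (hγ : 0 < γ)
    (hT0 : ∀ s a s', 0 ≤ T s a s') (hT1 : ∀ s a, ∑ s' : S, T s a s' = 1)
    (hΩ0 : ∀ s' a o, 0 ≤ Ω s' a o) (hΩ1 : ∀ s' a, ∑ o : O, Ω s' a o = 1)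
    (α : A → S → ℝ) (c : ℝ) (hc : ∀ a s, α a s ≤ c) (a : A) (s : S) :
    FIB T Ω r γ α a s ≤ r s a + γ * c := by
  have key : ∑ o : O, ∑ s' : S, Ω s' a o * T s a s' * c = c := by
    rw [Finset.sum_comm]
    simp_rw [← Finset.sum_mul, hΩ1, one_mul, hT1]
    rw [one_mul]
  have h : ∑ o : O, Finset.univ.sup' Finset.univ_nonempty
      (fun a' : A => ∑ s' : S, Ω s' a o * T s a s' * α a' s') ≤ c := by
    refine le_trans (Finset.sum_le_sum fun o _ => ?_) key.le
    refine Finset.sup'_le _ _ fun a' _ => ?_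
    exact Finset.sum_le_sum fun s' _ =>
      mul_le_mul_of_nonneg_left (hc a' s') (mul_nonneg (hΩ0 _ _ _) (hT0 _ _ _))
  unfold FIB
  have := mul_le_mul_of_nonneg_left h hγ.le
  linarith

theorem fib_box_invariance
    (T : S → A → S → ℝ) (Ω : S → A → O → ℝ) (r : S → A → ℝ) (γ : ℝ)
    (hγ : 0 < γ) (hγ1 : γ < 1)
    (hT0 : ∀ s a s', 0 ≤ T s a s') (hT1 : ∀ s a, ∑ s' : S, T s a s' = 1)
    (hΩ0 : ∀ s' a o, 0 ≤ Ω s' a o) (hΩ1 : ∀ s' a, ∑ o : O, Ω s' a o = 1)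
    (αstar : A → S → ℝ) (hstar : FIB T Ω r γ αstar = αstar)
    (rmin rmax : ℝ) (hr : ∀ s a, rmin ≤ r s a ∧ r s a ≤ rmax) :
    (∀ α : A → S → ℝ,
      (∀ a s, rmin / (1 - γ) ≤ α a s ∧ α a s ≤ rmax / (1 - γ)) →
      ∀ a s, rmin / (1 - γ) ≤ FIB T Ω r γ α a s ∧
        FIB T Ω r γ α a s ≤ rmax / (1 - γ)) ∧
    (∀ a s, rmin / (1 - γ) ≤ αstar a s ∧ αstar a s ≤ rmax / (1 - γ)) := by
  have h1 : 0 < 1 - γ := by linarith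
  refine ⟨fun α hα a s => ⟨?_, ?_⟩, fun a s => ⟨?_, ?_⟩⟩
  · have := fib_lower_aux T Ω r γ hγ hT0 hT1 hΩ0 hΩ1 α _ (fun a s => (hα a s).1) a s
    have e : rmin / (1 - γ) * (1 - γ) = rmin := div_mul_cancel₀ _ h1.ne'
    linarith [(hr s a).1]
  · have := fib_upper_aux T Ω r γ hγ hT0 hT1 hΩ0 hΩ1 α _ (fun a s => (hα a s).2) a s
    have e : rmax / (1 - γ) * (1 - γ) = rmax := div_mul_cancel₀ _ h1.ne'
    linarith [(hr s a).2]
  · obtain ⟨p, hp⟩ := Finite.exists_min (fun p : A × S => αstar p.1 p.2)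
    have := fib_lower_aux T Ω r γ hγ hT0 hT1 hΩ0 hΩ1 αstar _ (fun a s => hp (a, s)) p.1 p.2
    rw [hstar] at this
    refine le_trans ?_ (hp (a, s))
    rw [div_le_iff₀ h1]
    linarith [(hr p.2 p.1).1]
  · obtain ⟨p, hp⟩ := Finite.exists_max (fun p : A × S => αstar p.1 p.2)
    have := fib_upper_aux T Ω r γ hγ hT0 hT1 hΩ0 hΩ1 αstar _ (fun a s => hp (a, s)) p.1 p.2
    rw [hstar] at this
    refine le_trans (hp (a, s)) ?_
    rw [le_div_iff₀ h1]
    linarith [(hr p.2 p.1).2]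
end

section
/- The FIB update upper-bounds the exact belief-space Bellman backup: for every α : A → S → ℝ, every belief b : S → ℝ with b s ≥ 0 for all s and Σ_s b s = 1, and every action a ∈ A, it holds that Σ_s r s a · b s + γ · Σ_{o ∈ O} max_{a' ∈ A} Σ_{s' ∈ S} α a' s' · (Σ_{s ∈ S} Ω s' a o · T s a s' · b s) ≤ Σ_s b s · (F α) a s. (The left-hand side equals R(b,a) + γ Σ_o Pr(o|b,a) V_α(τ(b,a,o)), the exact Bellman backup for action a of the value function V_α(b) = max_{a'} Σ_s α a' s · b s, written in unnormalized form so that observations with Pr(o|b,a) = 0 contribute zero.) -/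
open Finset Filter

variable {S A O : Type*} [Fintype S] [Fintype A] [Fintype O]
  [Nonempty S] [Nonempty A] [Nonempty O]

theorem fib_upper_bounds_bellman_backup
    (T : S → A → S → ℝ) (Ω : S → A → O → ℝ) (r : S → A → ℝ) (γ : ℝ)
    (hγ : 0 < γ) (hγ1 : γ < 1)
    (hT0 : ∀ s a s', 0 ≤ T s a s') (hT1 : ∀ s a, ∑ s' : S, T s a s' = 1)
    (hΩ0 : ∀ s' a o, 0 ≤ Ω s' a o) (hΩ1 : ∀ s' a, ∑ o : O, Ω s' a o = 1)
    :
    ∀ α : A → S → ℝ, ∀ b : S → ℝ,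
      (∀ s, 0 ≤ b s) → (∑ s : S, b s = 1) →
      ∀ a : A,
        (∑ s : S, r s a * b s) + γ * ∑ o : O,
          Finset.univ.sup' Finset.univ_nonempty
            (fun a' : A => ∑ s' : S, α a' s' * ∑ s : S, Ω s' a o * T s a s' * b s)
        ≤ ∑ s : S, b s * FIB T Ω r γ α a s := by
  intro α b hb _ a
  have key : ∀ o : O, Finset.univ.sup' Finset.univ_nonempty
      (fun a' : A => ∑ s' : S, α a' s' * ∑ s : S, Ω s' a o * T s a s' * b s)
      ≤ ∑ s : S, b s * Finset.univ.sup' Finset.univ_nonempty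
        (fun a' : A => ∑ s' : S, Ω s' a o * T s a s' * α a' s') := by
    intro o
    apply Finset.sup'_le
    intro a' _
    have h : ∑ s' : S, α a' s' * ∑ s : S, Ω s' a o * T s a s' * b s
        = ∑ s : S, b s * ∑ s' : S, Ω s' a o * T s a s' * α a' s' := by
      simp only [Finset.mul_sum]
      rw [Finset.sum_comm]
      refine Finset.sum_congr rfl fun s _ => Finset.sum_congr rfl fun s' _ => ?_
      ring
    rw [h]
    refine Finset.sum_le_sum fun s _ => mul_le_mul_of_nonneg_left ?_ (hb s)
    exact Finset.le_sup' (fun a' : A => ∑ s' : S, Ω s' a o * T s a s' * α a' s')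
      (Finset.mem_univ a')
  have h2 : ∑ s : S, b s * FIB T Ω r γ α a s = (∑ s : S, r s a * b s) + γ * ∑ o : O,
      ∑ s : S, b s * Finset.univ.sup' Finset.univ_nonempty
        (fun a' : A => ∑ s' : S, Ω s' a o * T s a s' * α a' s') := by
    rw [Finset.sum_comm, Finset.mul_sum, ← Finset.sum_add_distrib]
    refine Finset.sum_congr rfl fun s _ => ?_
    rw [← Finset.mul_sum, FIB]
    ring
  rw [h2]
  have h3 := mul_le_mul_of_nonneg_left (Finset.sum_le_sum fun o (_ : o ∈ Finset.univ) => key o) hγ.le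
  linarith
end

section
/- The FIB update is componentwise bounded above by the QMDP update: for every α : A → S → ℝ, every s ∈ S, and every a ∈ A, (F α) a s ≤ r s a + γ · Σ_{s' ∈ S} T s a s' · max_{a' ∈ A} α a' s'. -/
open Finset Filter

variable {S A O : Type*} [Fintype S] [Fintype A] [Fintype O]
  [Nonempty S] [Nonempty A] [Nonempty O]

theorem fib_le_qmdp
    (T : S → A → S → ℝ) (Ω : S → A → O → ℝ) (r : S → A → ℝ) (γ : ℝ)
    (hγ : 0 < γ) (hγ1 : γ < 1)
    (hT0 : ∀ s a s', 0 ≤ T s a s') (hT1 : ∀ s a, ∑ s' : S, T s a s' = 1)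
    (hΩ0 : ∀ s' a o, 0 ≤ Ω s' a o) (hΩ1 : ∀ s' a, ∑ o : O, Ω s' a o = 1)
    :
    ∀ α : A → S → ℝ, ∀ s : S, ∀ a : A,
      FIB T Ω r γ α a s ≤
        r s a + γ * ∑ s' : S, T s a s' *
          Finset.univ.sup' Finset.univ_nonempty (fun a' : A => α a' s') := by
  intro α s a
  unfold FIB
  have key : ∑ o : O, Finset.univ.sup' Finset.univ_nonempty
      (fun a' : A => ∑ s' : S, Ω s' a o * T s a s' * α a' s') ≤
      ∑ o : O, ∑ s' : S, Ω s' a o * T s a s' *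
        Finset.univ.sup' Finset.univ_nonempty (fun a' : A => α a' s') := by
    refine Finset.sum_le_sum fun o _ => Finset.sup'_le _ _ fun b _ => ?_
    refine Finset.sum_le_sum fun s' _ => ?_
    exact mul_le_mul_of_nonneg_left
      (Finset.le_sup' (fun a' : A => α a' s') (Finset.mem_univ b))
      (mul_nonneg (hΩ0 _ _ _) (hT0 _ _ _))
  rw [Finset.sum_comm] at key
  simp only [mul_assoc, ← Finset.sum_mul, hΩ1, one_mul] at key
  simp only [mul_assoc]
  have := mul_le_mul_of_nonneg_left key hγ.le
  linarith
end
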